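/- Let p be a prime and q = p^a. For 0 ≤ k ≤ q−2 with base-p digit sum σ(k), the p-adic valuation of the Gauss sum G_k(q) = −Σ_{x ∈ F_q^*} χ(x)^{−k} ζ_p^{Tr(x)} equals σ(k)/(p−1), where the valuation is normalized so that ord_p(p) = 1. -/

import Mathlib

open Finset

/-- A `ℚ`-valued additive valuation on the nonzero elements of a field. -/
structure IsRatValuation {K : Type*} [Field K] (v : K → ℚ) : Prop where
  map_mul : ∀ x y : K, x ≠ 0 → y ≠ 0 → v (x * y) = v x + v y
  map_add : ∀ x y : K, x ≠ 0 → y ≠ 0 → x + y ≠ 0 → min (v x) (v y) ≤ v (x + y)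

namespace IsRatValuation

variable {K : Type*} [Field K] {v : K → ℚ} (hv : IsRatValuation v)
include hv

theorem map_one : v 1 = 0 := by
  have := hv.map_mul 1 1 one_ne_zero one_ne_zero
  rw [mul_one] at this
  linarith

theorem map_pow {x : K} (hx : x ≠ 0) (n : ℕ) : v (x ^ n) = n * v x := by
  induction n with
  | zero => simp [hv.map_one]
  | succ n ih =>
    rw [pow_succ, hv.map_mul _ _ (pow_ne_zero n hx) hx, ih]
    push_cast
    ring

theorem map_inv {x : K} (hx : x ≠ 0) : v x⁻¹ = -v x := by
  have := hv.map_mul x x⁻¹ hx (inv_ne_zero hx)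
  rw [mul_inv_cancel₀ hx, hv.map_one] at this
  linarith

theorem map_eq_zero_of_pow_eq_one {x : K} {n : ℕ} (hn : n ≠ 0) (hx : x ^ n = 1) : v x = 0 := by
  have hx0 : x ≠ 0 := by
    rintro rfl
    simp [hn] at hx
  have := hv.map_pow hx0 n
  rw [hx, hv.map_one, eq_comm, mul_eq_zero] at this
  exact this.resolve_left (by exact_mod_cast hn)

theorem map_neg (x : K) : v (-x) = v x := by
  rcases eq_or_ne x 0 with rfl | hx
  · simp
  rw [neg_eq_neg_one_mul, hv.map_mul _ _ (by simp) hx,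
    hv.map_eq_zero_of_pow_eq_one two_ne_zero (by norm_num : (-1 : K) ^ 2 = 1), zero_add]

/-- The valuation ring of a `ℚ`-valued additive valuation. -/
def valuationSubring : ValuationSubring K where
  carrier := {x | x = 0 ∨ 0 ≤ v x}
  mul_mem' := by
    rintro x y hx hy
    by_cases hx0 : x = 0
    · simp [hx0]
    by_cases hy0 : y = 0
    · simp [hy0]
    exact .inr (hv.map_mul x y hx0 hy0 ▸ add_nonneg (hx.resolve_left hx0) (hy.resolve_left hy0))
  one_mem' := .inr hv.map_one.ge
  add_mem' := by
    rintro x y hx hy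
    by_cases hx0 : x = 0
    · simpa [hx0] using hy
    by_cases hy0 : y = 0
    · simpa [hy0] using hx
    by_cases hxy : x + y = 0
    · exact .inl hxy
    exact .inr ((le_min (hx.resolve_left hx0) (hy.resolve_left hy0)).trans
      (hv.map_add x y hx0 hy0 hxy))
  zero_mem' := .inl rfl
  neg_mem' := by
    rintro x (rfl | hx)
    · simp
    · exact .inr (by rwa [hv.map_neg])
  mem_or_inv_mem' x := by
    by_cases hx0 : x = 0
    · exact .inl (.inl hx0)
    rcases le_total 0 (v x) with h | h
    · exact .inl (.inr h)
    · exact .inr (.inr (by rw [hv.map_inv hx0]; linarith))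

theorem mem_valuationSubring {x : K} : x ∈ hv.valuationSubring ↔ x = 0 ∨ 0 ≤ v x := Iff.rfl

theorem mem_of_pow_eq_one {x : K} {n : ℕ} (hn : n ≠ 0) (hx : x ^ n = 1) :
    x ∈ hv.valuationSubring :=
  .inr (hv.map_eq_zero_of_pow_eq_one hn hx).ge

theorem isUnit_iff {x : hv.valuationSubring} : IsUnit x ↔ (x : K) ≠ 0 ∧ v x = 0 := by
  constructor
  · intro h
    have hx0 : (x : K) ≠ 0 := by simpa using h.ne_zero
    obtain ⟨y, hy⟩ := h.exists_right_inv
    have hxy : (x : K) * y = 1 := by exact_mod_cast congrArg Subtype.val hy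
    have hy0 : (y : K) ≠ 0 := right_ne_zero_of_mul_eq_one hxy
    have h1 := hv.map_mul _ _ hx0 hy0
    rw [hxy, hv.map_one] at h1
    have h2 := (hv.mem_valuationSubring.1 x.2).resolve_left hx0
    have h3 := (hv.mem_valuationSubring.1 y.2).resolve_left hy0
    exact ⟨hx0, by linarith⟩
  · rintro ⟨hx0, hx⟩
    refine IsUnit.of_mul_eq_one ⟨(x : K)⁻¹, .inr (by rw [hv.map_inv hx0, hx, neg_zero])⟩ ?_
    exact Subtype.ext (mul_inv_cancel₀ hx0)

theorem residue_eq_zero_iff {x : hv.valuationSubring} :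
    IsLocalRing.residue hv.valuationSubring x = 0 ↔ (x : K) = 0 ∨ 0 < v x := by
  rw [IsLocalRing.residue_eq_zero_iff, IsLocalRing.mem_maximalIdeal, mem_nonunits_iff,
    hv.isUnit_iff, not_and_or, not_not]
  have := hv.mem_valuationSubring.1 x.2
  refine or_congr_right' fun h => ?_
  exact ⟨fun h' => lt_of_le_of_ne (this.resolve_left h) (Ne.symm h'), ne_of_gt⟩

/-- The uniformizer `ζ - 1` of the `p`-th cyclotomic field has valuation at most `1 / (p - 1)`. -/
theorem sub_one_mul_map_zeta_sub_one_le {p : ℕ} [Fact p.Prime] (hvp : v (p : K) = 1)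
    (hp0 : (p : K) ≠ 0) {ζ : K} (hζ : IsPrimitiveRoot ζ p) :
    ((p : ℚ) - 1) * v (ζ - 1) ≤ 1 := by
  have hp := Fact.out (p := p.Prime)
  obtain ⟨n, rfl⟩ : ∃ n, p = n + 1 := ⟨p - 1, (Nat.sub_add_cancel hp.one_le).symm⟩
  have hprod := hζ.prod_one_sub_pow_eq_order
  have h1 : ζ - 1 ≠ 0 := sub_ne_zero.2 (hζ.ne_one hp.one_lt)
  have hne : ∏ k ∈ range n, ((∑ i ∈ range (k + 1), ζ ^ i) * (-1)) ≠ 0 ∧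
      (n : K) + 1 = (ζ - 1) ^ n * ∏ k ∈ range n, ((∑ i ∈ range (k + 1), ζ ^ i) * (-1)) := by
    have : (n : K) + 1 = (ζ - 1) ^ n *
        ∏ k ∈ range n, ((∑ i ∈ range (k + 1), ζ ^ i) * (-1)) := by
      rw [← hprod, ← Finset.card_range n, ← Finset.prod_const, Finset.card_range,
        ← Finset.prod_mul_distrib]
      refine Finset.prod_congr rfl fun k _ => ?_
      rw [← mul_assoc, mul_geom_sum]
      ring
    refine ⟨fun h => hp0 ?_, this⟩
    rw [h, mul_zero] at this
    exact_mod_cast this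
  have hζO := hv.mem_of_pow_eq_one hp.ne_zero hζ.pow_eq_one
  have hmem : ∏ k ∈ range n, ((∑ i ∈ range (k + 1), ζ ^ i) * (-1)) ∈ hv.valuationSubring :=
    prod_mem fun k _ => mul_mem (sum_mem fun i _ => pow_mem hζO i) (neg_mem (one_mem _))
  have h2 := (hv.mem_valuationSubring.1 hmem).resolve_left hne.1
  have h3 := hv.map_mul _ _ (pow_ne_zero n h1) hne.1
  push_cast at hvp ⊢
  rw [← hne.2, hv.map_pow h1, hvp] at h3
  linarith

end IsRatValuation

section DigitSum

theorem Nat.sum_digits_add_mul {p : ℕ} (hp : 1 < p) {r : ℕ} (hr : r < p) (m : ℕ) :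
    (p.digits (r + p * m)).sum = r + (p.digits m).sum := by
  rcases eq_or_ne r 0 with rfl | h
  · rcases eq_or_ne m 0 with rfl | hm
    · simp
    · rw [Nat.digits_add p hp 0 m hr (.inr hm), List.sum_cons]
  · rw [Nat.digits_add p hp r m hr (.inl h), List.sum_cons]

theorem Nat.sum_digits_add_sum_digits_compl {p : ℕ} (hp : 1 < p) (a : ℕ) {k l : ℕ}
    (h : k + l + 1 = p ^ a) : (p.digits k).sum + (p.digits l).sum = a * (p - 1) := by
  induction a generalizing k l with
  | zero =>
    obtain ⟨rfl, rfl⟩ : k = 0 ∧ l = 0 := by simpa using h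
    simp
  | succ a ih =>
    have hk := Nat.mod_add_div k p
    have hl := Nat.mod_add_div l p
    have hkp := Nat.mod_lt k (by lia : p > 0)
    have hlp := Nat.mod_lt l (by lia : p > 0)
    rw [← hk, ← hl, Nat.sum_digits_add_mul hp hkp, Nat.sum_digits_add_mul hp hlp]
    rw [← hk, ← hl, pow_succ'] at h
    have hdvd : p ∣ k % p + l % p + 1 := by
      refine (Nat.dvd_add_right (dvd_mul_right p (k / p + l / p))).1 ?_
      exact ⟨p ^ a, by rw [← h]; ring⟩
    obtain ⟨c, hc⟩ := hdvd
    obtain rfl : c = 1 := by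
      have h1 : p * c < p * 2 := by lia
      have h2 := lt_of_mul_lt_mul_left h1 (Nat.zero_le p)
      have h3 : c ≠ 0 := by rintro rfl; simp at hc
      lia
    have h' : k / p + l / p + 1 = p ^ a :=
      Nat.eq_of_mul_eq_mul_left (by lia : 0 < p) (by rw [← h]; linarith)
    have := ih h'
    rw [add_mul, one_mul, ← this]
    lia

/-- A function that is subadditive below `N` and at most `c` on powers of `p`
is bounded by `c` times the digit sum. -/
theorem le_sum_digits_mul_of_subadditive {p : ℕ} (hp : 1 < p) {N : ℕ} {s : ℕ → ℚ} {c : ℚ}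
    (h0 : s 0 ≤ 0) (hadd : ∀ m n, m + n < N → s (m + n) ≤ s m + s n)
    (hpow : ∀ i, p ^ i < N → s (p ^ i) ≤ c) {k : ℕ} (hk : k < N) :
    s k ≤ (p.digits k).sum * c := by
  have hmul : ∀ i r, p ^ i * r < N → s (p ^ i * r) ≤ r * c := by
    intro i r
    induction r with
    | zero => simpa using fun _ => h0
    | succ r ih =>
      intro hr
      rw [mul_add, mul_one] at hr ⊢
      rcases r.eq_zero_or_pos with rfl | hr0
      · simpa using hpow i (by simpa using hr)
      · have := hadd _ _ hr
        have := ih (by lia)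
        have := hpow i (by lia)
        push_cast
        linarith
  suffices ∀ m i, p ^ i * m < N → s (p ^ i * m) ≤ (p.digits m).sum * c by
    simpa using this k 0 (by simpa using hk)
  intro m
  induction m using Nat.strong_induction_on with
  | _ m ih =>
    intro i hm
    rcases m.eq_zero_or_pos with rfl | hm0
    · simpa using h0
    have hmod := Nat.mod_add_div m p
    have hsplit : p ^ i * m = p ^ i * (m % p) + p ^ (i + 1) * (m / p) := by
      conv_lhs => rw [← hmod]
      ring
    have hdig := Nat.sum_digits_add_mul hp (Nat.mod_lt m (by lia)) (m / p)
    rw [hmod] at hdig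
    rw [hsplit] at hm ⊢
    have h1 := hadd _ _ hm
    have h2 := hmul i (m % p) (by lia)
    have h3 := ih (m / p) (Nat.div_lt_self hm0 hp) (i + 1) (by lia)
    rw [hdig, Nat.cast_add, add_mul]
    linarith

end DigitSum

namespace FiniteField

variable {F : Type*} [Field F] [Fintype F]

theorem sum_inv_pow_mul_pow {m n : ℕ} (hm : m ≠ 0) (hmq : m ≤ Fintype.card F - 1) :
    ∑ x : F, x⁻¹ ^ m * x ^ n =
      if Fintype.card F - 1 ∣ Fintype.card F - 1 - m + n then -1 else 0 := by
  classical
  rw [← sum_pow_units F, Fintype.sum_eq_add_sum_compl 0, inv_zero, zero_pow hm, zero_mul, zero_add]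
  symm
  refine Finset.sum_bij (fun u _ => (u : F)) (by simp) (fun _ _ _ _ h => Units.ext h)
    (fun x hx => ⟨Units.mk0 x (by simpa using hx), by simp⟩) fun u _ => ?_
  rw [pow_add]
  congr 1
  rw [inv_pow]
  refine eq_inv_of_mul_eq_one_left ?_
  rw [← pow_add, Nat.sub_add_cancel hmq]
  exact FiniteField.pow_card_sub_one_eq_one _ u.ne_zero

theorem sum_inv_pow_mul_ne_zero {p a : ℕ} [Fact p.Prime] (hF : Fintype.card F = p ^ a)
    [Algebra (ZMod p) F] {l : F →+ ZMod p} (hl : l ≠ 0) {i : ℕ} (hi : p ^ i < p ^ a) :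
    ∑ x : F, x⁻¹ ^ p ^ i * algebraMap (ZMod p) F (l x) ≠ 0 := by
  have hp := Fact.out (p := p.Prime)
  have hfin : Module.finrank (ZMod p) F = a := by
    have := Module.card_eq_pow_finrank (K := ZMod p) (V := F)
    rw [ZMod.card, hF] at this
    exact (Nat.pow_right_injective hp.two_le this).symm
  have hia : i < a := (Nat.pow_lt_pow_iff_right hp.one_lt).1 hi
  let L : Module.Dual (ZMod p) F := l.toZModLinearMap p
  let c := ((Algebra.traceForm (ZMod p) F).toDual (traceForm_nondegenerate _ _)).symm L
  have hLc : ∀ x, l x = Algebra.trace (ZMod p) F (c * x) := fun x =>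
    (LinearMap.BilinForm.apply_toDual_symm_apply (hB := traceForm_nondegenerate (ZMod p) F)
      (f := L) x).symm
  have hc0 : c ≠ 0 := by
    intro h
    apply hl
    ext x
    simp [hLc, h]
  have hmain : ∑ x : F, x⁻¹ ^ p ^ i * algebraMap (ZMod p) F (l x) = -c ^ p ^ i := by
    have hsum : ∀ x : F, x⁻¹ ^ p ^ i * algebraMap (ZMod p) F (l x) =
        ∑ j ∈ range a, c ^ p ^ j * (x⁻¹ ^ p ^ i * x ^ p ^ j) := fun x => by
      rw [hLc, algebraMap_trace_eq_sum_pow, hfin, Nat.card_zmod, mul_sum]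
      exact Finset.sum_congr rfl fun j _ => by ring
    simp_rw [hsum]
    rw [Finset.sum_comm]
    simp_rw [← mul_sum]
    rw [Finset.sum_eq_single i]
    · rw [sum_inv_pow_mul_pow (pow_ne_zero _ hp.ne_zero) (by lia), Nat.sub_add_cancel (by lia)]
      simp
    · intro j hj hji
      rw [sum_inv_pow_mul_pow (pow_ne_zero _ hp.ne_zero) (by lia), if_neg, mul_zero]
      have hja : p ^ j < p ^ a := Nat.pow_lt_pow_right hp.one_lt (Finset.mem_range.1 hj)
      have hne : p ^ j ≠ p ^ i := fun h => hji (Nat.pow_right_injective hp.two_le h)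
      have := Nat.pow_pos (n := j) hp.pos
      have := Nat.pow_pos (n := i) hp.pos
      rw [hF]
      rintro ⟨t, ht⟩
      rcases t with _ | _ | t
      · lia
      · lia
      · have : (p ^ a - 1) * 2 ≤ (p ^ a - 1) * (t + 1 + 1) := Nat.mul_le_mul_left _ (by lia)
        lia
    · intro h
      exact absurd (Finset.mem_range.2 hia) h
  rw [hmain]
  exact neg_ne_zero.2 (pow_ne_zero _ hc0)

end FiniteField

namespace IsRatValuation

variable {F K : Type*} [Field F] [Fintype F] [Field K] {v : K → ℚ} (hv : IsRatValuation v)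
include hv

theorem mulChar_apply_mem (χ : MulChar F K) (x : F) : χ x ∈ hv.valuationSubring := by
  classical
  rcases eq_or_ne x 0 with rfl | hx
  · rw [MulChar.map_zero]
    exact zero_mem _
  · refine hv.mem_of_pow_eq_one Fintype.card_ne_zero (n := Fintype.card Fˣ) ?_
    rw [Fintype.card_units, ← _root_.map_pow, FiniteField.pow_card_sub_one_eq_one x hx,
      _root_.map_one]

theorem jacobiSum_mem (χ φ : MulChar F K) : jacobiSum χ φ ∈ hv.valuationSubring :=
  sum_mem fun _ _ => mul_mem (hv.mulChar_apply_mem χ _) (hv.mulChar_apply_mem φ _)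

theorem map_gaussSum_mul_le {χ φ : MulChar F K} (h : χ * φ ≠ 1) {ψ : AddChar F K}
    (hχ : gaussSum χ ψ ≠ 0) (hφ : gaussSum φ ψ ≠ 0) :
    v (gaussSum (χ * φ) ψ) ≤ v (gaussSum χ ψ) + v (gaussSum φ ψ) := by
  have hJ := jacobiSum_mul_nontrivial h ψ
  have hne := mul_ne_zero hχ hφ
  rw [← hJ] at hne
  rw [← hv.map_mul _ _ hχ hφ, ← hJ,
    hv.map_mul _ _ (left_ne_zero_of_mul hne) (right_ne_zero_of_mul hne)]
  have := (hv.mem_valuationSubring.1 (hv.jacobiSum_mem χ φ)).resolve_left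
    (right_ne_zero_of_mul hne)
  linarith

theorem map_gaussSum_add_map_gaussSum_inv (hF : (Fintype.card F : K) ≠ 0) {χ : MulChar F K}
    (hχ : χ ≠ 1) {ψ : AddChar F K} (hψ : ψ.IsPrimitive) :
    v (gaussSum χ ψ) + v (gaussSum χ⁻¹ ψ) = v (Fintype.card F : K) := by
  have h := gaussSum_mul_gaussSum_eq_card hχ hψ
  have hne : gaussSum χ ψ * gaussSum χ⁻¹ ψ⁻¹ ≠ 0 := h ▸ hF
  have hsq : (χ⁻¹ (-1)) ^ 2 = 1 := by rw [← _root_.map_pow, neg_one_sq, _root_.map_one]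
  rw [← h, hv.map_mul _ _ (left_ne_zero_of_mul hne) (right_ne_zero_of_mul hne),
    ← mul_gaussSum_inv_eq_gaussSum χ⁻¹ ψ,
    hv.map_mul _ _ (fun h0 => by simp [h0] at hsq) (right_ne_zero_of_mul hne),
    hv.map_eq_zero_of_pow_eq_one two_ne_zero hsq, zero_add]

/-- The embedding of `F` in the residue field induced by a Teichmüller character. -/
noncomputable def residueHom {χ : MulChar F K}
    (hteich : ∀ x y : F, χ (x + y) - χ x - χ y = 0 ∨ 0 < v (χ (x + y) - χ x - χ y)) :
    F →+* IsLocalRing.ResidueField hv.valuationSubring where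
  toFun x := IsLocalRing.residue _ ⟨χ x, hv.mulChar_apply_mem χ x⟩
  map_one' := by
    rw [← (IsLocalRing.residue hv.valuationSubring).map_one]
    exact congrArg _ (Subtype.ext (_root_.map_one χ))
  map_mul' x y := by
    rw [← (IsLocalRing.residue hv.valuationSubring).map_mul]
    exact congrArg _ (Subtype.ext (_root_.map_mul χ x y))
  map_zero' := by
    rw [← (IsLocalRing.residue hv.valuationSubring).map_zero]
    exact congrArg _ (Subtype.ext χ.map_zero)
  map_add' x y := by
    rw [← sub_eq_zero, ← sub_sub, ← _root_.map_sub, ← _root_.map_sub, hv.residue_eq_zero_iff]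
    exact hteich x y

/-- The Gauss sum of `χ ^ (-p ^ i)` is a unit multiple of `ζ - 1`. -/
theorem map_gaussSum_inv_pow_eq {p a : ℕ} [Fact p.Prime] (hF : Fintype.card F = p ^ a)
    {χ : MulChar F K}
    (hteich : ∀ x y : F, χ (x + y) - χ x - χ y = 0 ∨ 0 < v (χ (x + y) - χ x - χ y))
    {ψ : AddChar F K} (hψ : ψ ≠ 1) {ζ : K} (hζ : IsPrimitiveRoot ζ p) {i : ℕ}
    (hi : p ^ i < p ^ a) (hχ : χ⁻¹ ^ p ^ i ≠ 1) :
    v (gaussSum (χ⁻¹ ^ p ^ i) ψ) = v (ζ - 1) := by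
  have hp := Fact.out (p := p.Prime)
  have : CharP F p := charP_of_card_eq_prime_pow hF
  let : Algebra (ZMod p) F := ZMod.algebra F p
  let ρ := hv.residueHom hteich
  have : CharP (IsLocalRing.ResidueField hv.valuationSubring) p :=
    charP_of_injective_ringHom ρ.injective p
  have hψp : ∀ x, ψ x ^ p = 1 := fun x => by
    rw [← AddChar.map_nsmul_eq_pow, nsmul_eq_mul, CharP.cast_eq_zero, zero_mul,
      AddChar.map_zero_eq_one]
  have := NeZero.of_pos hp.pos
  choose n hnp hn using fun x => hζ.eq_pow_of_pow_eq_one (hψp x)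
  let l : F →+ ZMod p := AddMonoidHom.mk' (fun x => (n x : ZMod p)) fun x y => by
    rw [← Nat.cast_add, ← ZMod.natCast_mod (n x + n y) p]
    refine congrArg _ (hζ.pow_inj (hnp _) (Nat.mod_lt _ hp.pos) ?_)
    rw [hζ.eq_orderOf, pow_mod_orderOf, pow_add, hn, hn, hn, AddChar.map_add_eq_mul]
  have hl : l ≠ 0 := by
    intro h
    refine hψ (DFunLike.ext _ _ fun x => ?_)
    have h1 : (n x : ZMod p) = 0 := DFunLike.congr_fun h x
    rw [← hn x, AddChar.one_apply, Nat.eq_zero_of_dvd_of_lt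
      ((ZMod.natCast_eq_zero_iff _ _).1 h1) (hnp x), pow_zero]
  let z : hv.valuationSubring := ⟨ζ, hv.mem_of_pow_eq_one hp.ne_zero hζ.pow_eq_one⟩
  have hz : IsLocalRing.residue _ z = 1 := by
    have hzp : z ^ p = 1 := Subtype.ext hζ.pow_eq_one
    rw [← sub_eq_zero, ← pow_eq_zero_iff hp.ne_zero, sub_pow_char, one_pow, ← _root_.map_pow,
      hzp, _root_.map_one, sub_self]
  let T : hv.valuationSubring := ∑ x : F, ⟨χ x⁻¹, hv.mulChar_apply_mem χ _⟩ ^ p ^ i *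
    ∑ j ∈ range (n x), z ^ j
  have hT : IsLocalRing.residue _ T ≠ 0 := by
    have : IsLocalRing.residue _ T =
        ρ (∑ x : F, x⁻¹ ^ p ^ i * algebraMap (ZMod p) F (l x)) := by
      simp only [T, l, _root_.map_sum, _root_.map_mul, _root_.map_pow, hz, AddMonoidHom.mk'_apply,
        map_natCast, one_pow, sum_const, card_range, nsmul_one]
      rfl
    rw [this, Ne, map_eq_zero]
    exact FiniteField.sum_inv_pow_mul_ne_zero hF hl hi
  have hG : gaussSum (χ⁻¹ ^ p ^ i) ψ = T * (ζ - 1) := by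
    have h0 := MulChar.sum_eq_zero_of_ne_one hχ
    rw [← sub_zero (gaussSum _ _), ← h0, gaussSum, ← sum_sub_distrib]
    simp only [T, AddSubmonoidClass.coe_finsetSum, MulMemClass.coe_mul, SubmonoidClass.coe_pow,
      sum_mul]
    refine Finset.sum_congr rfl fun x _ => ?_
    rw [mul_assoc, geom_sum_mul, hn, MulChar.pow_apply' _ (pow_ne_zero i hp.ne_zero),
      MulChar.inv_apply', mul_sub, mul_one]
  have hTu := hv.isUnit_iff.1 ((IsLocalRing.residue_ne_zero_iff_isUnit T).1 hT)
  rw [hG, hv.map_mul _ _ hTu.1 (sub_ne_zero.2 (hζ.ne_one hp.one_lt)), hTu.2, zero_add]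

end IsRatValuation

theorem MulChar.pow_eq_one_iff_card_sub_one_dvd {F K : Type*} [Field F] [Fintype F] [Field K]
    {χ : MulChar F K} (hχ : Function.Injective χ) {n : ℕ} :
    χ ^ n = 1 ↔ Fintype.card F - 1 ∣ n := by
  classical
  constructor
  · intro h
    obtain ⟨g, hg⟩ := IsCyclic.exists_generator (α := Fˣ)
    have hgn : g ^ n = 1 := by
      refine Units.ext (hχ ?_)
      rw [Units.val_pow_eq_pow_val, map_pow, ← MulChar.pow_apply_coe, h, MulChar.one_apply_coe,
        Units.val_one, map_one]
    rw [← Fintype.card_units, ← Nat.card_eq_fintype_card,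
      ← orderOf_eq_card_of_forall_mem_zpowers hg]
    exact orderOf_dvd_of_pow_eq_one hgn
  · rintro ⟨m, rfl⟩
    refine MulChar.ext fun u => ?_
    rw [MulChar.pow_apply_coe, ← map_pow, pow_mul, FiniteField.pow_card_sub_one_eq_one _ u.ne_zero,
      one_pow, map_one, MulChar.one_apply_coe]

/-- Stickelberger/Gross–Koblitz valuation of Gauss sums: let `p` be prime,
`q = p^a`, `F` a field with `q` elements, `K` a field with a `ℚ`-valued
additive valuation `v` (normalized by `v p = 1`), `χ` the Teichmüller character
of `F^*` (an injective multiplicative character whose lift is multiplicative and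
additive modulo the maximal ideal), and `ψ` a primitive additive character of
`F` (with values the `p`-th roots of unity `ζ_p^{Tr(·)}`). Then for
`0 ≤ k ≤ q − 2`, the Gauss sum `G_k(q) = −Σ_{x ∈ F^*} χ(x)^{−k} ψ(x)` has
`v (G_k(q)) = σ(k)/(p−1)`, where `σ(k)` is the base-`p` digit sum of `k`. -/
theorem stmt14 (p : ℕ) (hp : p.Prime) (a : ℕ) (ha : 0 < a) (q : ℕ)
    (hq : q = p ^ a)
    (F : Type*) [Field F] [Fintype F] (hF : Fintype.card F = q)
    (K : Type*) [Field K] (v : K → ℚ)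
    (hvmul : ∀ x y : K, x ≠ 0 → y ≠ 0 → v (x * y) = v x + v y)
    (hvadd : ∀ x y : K, x ≠ 0 → y ≠ 0 → x + y ≠ 0 → min (v x) (v y) ≤ v (x + y))
    (hvp : v ((p : ℕ) : K) = 1)
    (χ : MulChar F K) (hχinj : Function.Injective χ)
    (hteich : ∀ x y : F,
      χ (x + y) - χ x - χ y = 0 ∨ 0 < v (χ (x + y) - χ x - χ y))
    (ψ : AddChar F K) (hψ : ψ.IsPrimitive)
    (k : ℕ) (hk : k ≤ q - 2) :
    v (-gaussSum ((χ ^ k)⁻¹) ψ) = ((Nat.digits p k).sum : ℚ) / ((p : ℚ) - 1) := by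
  have : Fact p.Prime := ⟨hp⟩
  subst hq
  have hv : IsRatValuation v := ⟨hvmul, hvadd⟩
  have : CharP F p := charP_of_card_eq_prime_pow hF
  have hψ1 : ψ ≠ 1 := by simpa using hψ one_ne_zero
  obtain ⟨y, hy⟩ := AddChar.ne_one_iff.1 hψ1
  have hyp : ψ y ^ p = 1 := by
    rw [← AddChar.map_nsmul_eq_pow, nsmul_eq_mul, CharP.cast_eq_zero, zero_mul,
      AddChar.map_zero_eq_one]
  have hp0 : (p : K) ≠ 0 := by
    intro h
    have : CharP K p := (CharP.charP_iff_prime_eq_zero hp).2 h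
    refine hy (sub_eq_zero.1 ((pow_eq_zero_iff hp.ne_zero).1 ?_))
    rw [sub_pow_char, hyp, one_pow, sub_self]
  have hζ : IsPrimitiveRoot (ψ y) p := orderOf_eq_prime hyp hy ▸ IsPrimitiveRoot.orderOf _
  have hcard : (Fintype.card F : K) ≠ 0 := by
    rw [hF, Nat.cast_pow]
    exact pow_ne_zero a hp0
  have hvcard : v (Fintype.card F : K) = a := by
    rw [hF, Nat.cast_pow, hv.map_pow hp0, hvp, mul_one]
  have hq2 : p ≤ p ^ a := Nat.le_self_pow ha.ne' p
  have hθ : ∀ {n}, χ⁻¹ ^ n = 1 ↔ p ^ a - 1 ∣ n := fun {n} => by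
    rw [inv_pow, inv_eq_one, MulChar.pow_eq_one_iff_card_sub_one_dvd hχinj, hF]
  have hθ1 : ∀ {n}, n ≠ 0 → n < p ^ a - 1 → χ⁻¹ ^ n ≠ 1 := fun h0 hlt h =>
    h0 (Nat.eq_zero_of_dvd_of_lt (hθ.1 h) hlt)
  have hg0 : gaussSum (χ⁻¹ ^ 0) ψ = -1 := by rw [pow_zero, gaussSum_one_left hψ1]
  have hgne : ∀ n < p ^ a - 1, gaussSum (χ⁻¹ ^ n) ψ ≠ 0 := by
    intro n hn
    rcases eq_or_ne n 0 with rfl | h0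
    · rw [hg0]
      exact neg_ne_zero.2 one_ne_zero
    · exact gaussSum_ne_zero_of_nontrivial hcard (hθ1 h0 hn) hψ
  have hv0 : v (gaussSum (χ⁻¹ ^ 0) ψ) = 0 := by rw [hg0, hv.map_neg, hv.map_one]
  have hle : ∀ n < p ^ a - 1,
      v (gaussSum (χ⁻¹ ^ n) ψ) ≤ (p.digits n).sum * v (ψ y - 1) := by
    intro n hn
    refine le_sum_digits_mul_of_subadditive (s := fun n => v (gaussSum (χ⁻¹ ^ n) ψ)) hp.one_lt
      hv0.le (fun m n hmn => ?_) (fun i hi => ?_) hn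
    · rcases eq_or_ne (m + n) 0 with h0 | h0
      · obtain ⟨rfl, rfl⟩ : m = 0 ∧ n = 0 := by lia
        rw [add_zero, hv0, add_zero]
      · rw [pow_add]
        exact hv.map_gaussSum_mul_le (pow_add χ⁻¹ m n ▸ hθ1 h0 hmn) (hgne m (by lia))
          (hgne n (by lia))
    · exact (hv.map_gaussSum_inv_pow_eq hF hteich hψ1 hζ (by lia)
        (hθ1 (pow_ne_zero i hp.ne_zero) hi)).le
  have hp1 : (0 : ℚ) < p - 1 := by
    have : (1 : ℚ) < p := by exact_mod_cast hp.one_lt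
    linarith
  have hle' : ∀ n < p ^ a - 1,
      v (gaussSum (χ⁻¹ ^ n) ψ) ≤ (p.digits n).sum / ((p : ℚ) - 1) := by
    intro n hn
    refine (hle n hn).trans ?_
    rw [div_eq_mul_inv]
    refine mul_le_mul_of_nonneg_left ?_ (Nat.cast_nonneg _)
    rw [← one_div, le_div_iff₀' hp1]
    exact hv.sub_one_mul_map_zeta_sub_one_le hvp hp0 hζ
  rw [hv.map_neg, ← inv_pow]
  have hp2 := hp.two_le
  rcases eq_or_ne k 0 with rfl | hk0
  · rw [hv0, Nat.digits_zero, List.sum_nil, Nat.cast_zero, zero_div]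
  have hkq : k < p ^ a - 1 := by lia
  have hinv : (χ⁻¹ ^ k)⁻¹ = χ⁻¹ ^ (p ^ a - 1 - k) := by
    refine inv_eq_of_mul_eq_one_right ?_
    rw [← pow_add, hθ, Nat.add_sub_cancel' hkq.le]
  have hsum := hv.map_gaussSum_add_map_gaussSum_inv hcard (hθ1 hk0 hkq) hψ
  rw [hinv, hvcard] at hsum
  have h1 := hle' k hkq
  have h2 := hle' (p ^ a - 1 - k) (by lia)
  have hdig : (((p.digits k).sum : ℕ) : ℚ) + ((p.digits (p ^ a - 1 - k)).sum : ℕ) =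
      a * ((p : ℚ) - 1) := by
    have := Nat.sum_digits_add_sum_digits_compl hp.one_lt a
      (k := k) (l := p ^ a - 1 - k) (by lia)
    rw [← Nat.cast_add, this, Nat.cast_mul, Nat.cast_sub hp.one_le, Nat.cast_one]
  have hdiv : (((p.digits k).sum : ℕ) : ℚ) / ((p : ℚ) - 1) +
      ((p.digits (p ^ a - 1 - k)).sum : ℕ) / ((p : ℚ) - 1) = a := by
    rw [← add_div, hdig, mul_div_cancel_right₀ _ hp1.ne']
  linarith
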